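/- For any convex body K in ℝⁿ, the Lebesgue measure of K is at most the Lebesgue measure of its central symmetral (1/2)(K - K), with equality if and only if K is centrally symmetric (i.e., K = x + (-(K - x)) for some x, equivalently K - c = -(K - c) for some center c). -/

import Mathlib

open MeasureTheory Set Pointwise ENNReal

noncomputable section

/-- A convex body: compact, convex, with nonempty interior. -/
def IsConvexBody {V : Type*} [NormedAddCommGroup V] [NormedSpace ℝ V] (K : Set V) : Prop :=
  IsCompact K ∧ Convex ℝ K ∧ (interior K).Nonempty

/-- The central symmetral (1/2)(K + (-K)) of K. -/
def centralSymmetral {V : Type*} [NormedAddCommGroup V] [NormedSpace ℝ V] (K : Set V) : Set V :=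
  (2:ℝ)⁻¹ • (K + -K)

lemma cdf_props {a b : ℝ} (hab : a < b) {f : ℝ → ℝ} (hf : ContinuousOn f (Ioo a b))
    (fpos : ∀ s ∈ Ioo a b, 0 < f s) (hfi : IntegrableOn f (Ioo a b)) :
    ∃ F : ℝ → ℝ, StrictMonoOn F (Ioo a b) ∧ F '' Ioo a b = Ioo 0 (∫ s in Ioo a b, f s) ∧
      ∀ s ∈ Ioo a b, HasDerivAt F (f s) s := by
  have hIcc : IntegrableOn f (Icc a b) := by
    rwa [integrableOn_Icc_iff_integrableOn_Ioo]
  have hsub : ∀ x ∈ Icc a b, IntervalIntegrable f volume a x := fun x hx =>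
    (intervalIntegrable_iff_integrableOn_Icc_of_le hx.1).2
      (hIcc.mono_set (Icc_subset_Icc le_rfl hx.2))
  have hc : ContinuousOn (fun x => ∫ t in a..x, f t) (Icc a b) := by
    have := intervalIntegral.continuousOn_primitive_interval (μ := volume) (f := f) (a := a)
      (b := b) (by rwa [uIcc_of_le hab.le])
    rwa [uIcc_of_le hab.le] at this
  have hd : ∀ s ∈ Ioo a b, HasDerivAt (fun x => ∫ t in a..x, f t) (f s) s := by
    intro s hs
    refine intervalIntegral.integral_hasDerivAt_right (hsub s ⟨hs.1.le, hs.2.le⟩) ?_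
      (hf.continuousAt (isOpen_Ioo.mem_nhds hs))
    exact hf.stronglyMeasurableAtFilter isOpen_Ioo s hs
  have hm : StrictMonoOn (fun x => ∫ t in a..x, f t) (Icc a b) := by
    refine strictMonoOn_of_deriv_pos (convex_Icc a b) hc ?_
    intro x hx
    rw [interior_Icc] at hx
    rw [(hd x hx).deriv]
    exact fpos x hx
  have h0 : (fun x => ∫ t in a..x, f t) a = 0 := by simp
  have h1 : (fun x => ∫ t in a..x, f t) b = ∫ s in Ioo a b, f s := by
    simp only
    rw [intervalIntegral.integral_of_le hab.le, integral_Ioc_eq_integral_Ioo]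
  refine ⟨fun x => ∫ t in a..x, f t, hm.mono Ioo_subset_Icc_self, ?_, hd⟩
  apply Subset.antisymm
  · rintro _ ⟨x, hx, rfl⟩
    rw [← h1, ← h0]
    exact ⟨hm (left_mem_Icc.2 hab.le) ⟨hx.1.le, hx.2.le⟩ hx.1,
      hm ⟨hx.1.le, hx.2.le⟩ (right_mem_Icc.2 hab.le) hx.2⟩
  · have := intermediate_value_Ioo hab.le hc
    simp only at h0 h1
    rwa [h0, h1] at this

lemma exists_transport {a b a' b' : ℝ} (hab : a < b) (hab' : a' < b') {f g : ℝ → ℝ}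
    (hf : ContinuousOn f (Ioo a b))
    (fpos : ∀ s ∈ Ioo a b, 0 < f s) (hfi : IntegrableOn f (Ioo a b))
    (hg : ContinuousOn g (Ioo a' b'))
    (gpos : ∀ s ∈ Ioo a' b', 0 < g s) (hgi : IntegrableOn g (Ioo a' b')) {A B : ℝ}
    (hA : ∫ s in Ioo a b, f s = A) (hB : ∫ s in Ioo a' b', g s = B) (hA0 : 0 < A) (hB0 : 0 < B) :
    ∃ T : ℝ → ℝ, StrictMonoOn T (Ioo a b) ∧ T '' Ioo a b = Ioo a' b' ∧
      ∀ s ∈ Ioo a b, HasDerivAt T ((f s / A) / (g (T s) / B)) s := by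
  obtain ⟨F, Fm, Fi, Fd⟩ := cdf_props hab hf fpos hfi
  obtain ⟨G, Gm, Gi, Gd⟩ := cdf_props hab' hg gpos hgi
  rw [hA] at Fi
  rw [hB] at Gi
  have hFs : ∀ s ∈ Ioo a b, F s / A * B ∈ Ioo 0 B := by
    intro s hs
    have : F s ∈ Ioo 0 A := Fi ▸ mem_image_of_mem F hs
    refine ⟨mul_pos (div_pos this.1 hA0) hB0, ?_⟩
    have : F s / A < 1 := (div_lt_one hA0).2 this.2
    nlinarith
  have hex : ∀ y ∈ Ioo 0 B, ∃ x ∈ Ioo a' b', G x = y := by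
    intro y hy
    rw [← Gi] at hy
    exact hy
  choose! Q hQ hGQ using hex
  have hQG : ∀ x ∈ Ioo a' b', Q (G x) = x := by
    intro x hx
    have : G x ∈ Ioo 0 B := Gi ▸ mem_image_of_mem G hx
    exact Gm.injOn (hQ _ this) hx (hGQ _ this)
  have Qm : StrictMonoOn Q (Ioo 0 B) := by
    intro x hx y hy hxy
    rw [← Gm.lt_iff_lt (hQ x hx) (hQ y hy), hGQ x hx, hGQ y hy]
    exact hxy
  have Qi : Q '' Ioo 0 B = Ioo a' b' := by
    apply Subset.antisymm
    · rintro _ ⟨x, hx, rfl⟩; exact hQ x hx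
    · intro x hx
      exact ⟨G x, Gi ▸ mem_image_of_mem G hx, hQG x hx⟩
  have Qd : ∀ y ∈ Ioo 0 B, HasDerivAt Q (g (Q y))⁻¹ y := by
    intro y hy
    have hc : ContinuousAt Q y := Qm.continuousAt_of_image_mem_nhds (isOpen_Ioo.mem_nhds hy)
      (by rw [Qi]; exact isOpen_Ioo.mem_nhds (hQ y hy))
    refine HasDerivAt.of_local_left_inverse hc (Gd _ (hQ y hy)) (gpos _ (hQ y hy)).ne' ?_
    filter_upwards [isOpen_Ioo.mem_nhds hy] with z hz using hGQ z hz
  refine ⟨fun s => Q (F s / A * B), ?_, ?_, ?_⟩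
  · intro x hx y hy hxy
    apply Qm (hFs x hx) (hFs y hy)
    have := Fm hx hy hxy
    gcongr
  · apply Subset.antisymm
    · rintro _ ⟨x, hx, rfl⟩; exact hQ _ (hFs x hx)
    · intro x hx
      have h1 : G x ∈ Ioo 0 B := Gi ▸ mem_image_of_mem G hx
      have h2 : G x / B * A ∈ Ioo 0 A := by
        refine ⟨mul_pos (div_pos h1.1 hB0) hA0, ?_⟩
        have : G x / B < 1 := (div_lt_one hB0).2 h1.2
        nlinarith
      rw [← Fi] at h2
      obtain ⟨s, hs, hs'⟩ := h2
      refine ⟨s, hs, ?_⟩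
      simp only [hs']
      rw [mul_div_cancel_right₀ _ hA0.ne', div_mul_cancel₀ _ hB0.ne', hQG x hx]
  · intro s hs
    have h1 := (Qd _ (hFs s hs)).comp s (((Fd s hs).div_const A).mul_const B)
    have e : (f s / A) / (g (Q (F s / A * B)) / B)
        = (g (Q (F s / A * B)))⁻¹ * (f s / A * B) := by
      rw [div_div_eq_mul_div, div_eq_inv_mul]
    simp only [e]
    exact h1

lemma amgm_le {t p : ℝ} (ht : 0 < t) (hp0 : 0 < p) (hp1 : p < 1) :
    t ^ p ≤ (1 - p) + p * t := by
  by_cases h : t = 1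
  · subst h; simp
  · have := rpow_one_add_lt_one_add_mul_self (s := t - 1) (by linarith) (sub_ne_zero.2 h) hp0 hp1
    rw [add_sub_cancel] at this
    linarith

lemma amgm_eq {t p : ℝ} (ht : 0 < t) (hp0 : 0 < p) (hp1 : p < 1)
    (he : t ^ p = (1 - p) + p * t) : t = 1 := by
  by_contra h
  have := rpow_one_add_lt_one_add_mul_self (s := t - 1) (by linarith) (sub_ne_zero.2 h) hp0 hp1
  rw [add_sub_cancel] at this
  linarith

lemma oneD {a b a' b' : ℝ} (hab : a < b) (hab' : a' < b') {f g h : ℝ → ℝ}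
    (hf : ContinuousOn f (Ioo a b))
    (fpos : ∀ s ∈ Ioo a b, 0 < f s) (hfi : IntegrableOn f (Ioo a b))
    (hg : ContinuousOn g (Ioo a' b'))
    (gpos : ∀ s ∈ Ioo a' b', 0 < g s) (hgi : IntegrableOn g (Ioo a' b')) {A B : ℝ}
    (hA : ∫ s in Ioo a b, f s = A) (hB : ∫ s in Ioo a' b', g s = B) (hA0 : 0 < A) (hB0 : 0 < B)
    (h0 : ∀ s, 0 ≤ h s) (hi : Integrable h) {p : ℝ} (hp0 : 0 < p) (hp1 : p < 1)
    (hh : ∀ s ∈ Ioo a b, ∀ t ∈ Ioo a' b', f s ^ (1 - p) * g t ^ p ≤ h ((1 - p) * s + p * t)) :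
    A ^ (1 - p) * B ^ p ≤ ∫ s, h s ∧
    (A = B → ∫ s, h s = A → ∃ d, (∀ s, s ∈ Ioo a b ↔ s - d ∈ Ioo a' b') ∧
      ∀ s ∈ Ioo a b, f s = g (s - d)) := by
  obtain ⟨T, Tm, Ti, Td⟩ := exists_transport hab hab' hf fpos hfi hg gpos hgi hA hB hA0 hB0
  have Tmem : ∀ s ∈ Ioo a b, T s ∈ Ioo a' b' := fun s hs => Ti ▸ mem_image_of_mem T hs
  set D : ℝ → ℝ := fun s => (f s / A) / (g (T s) / B) with hD
  have Dpos : ∀ s ∈ Ioo a b, 0 < D s := fun s hs =>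
    div_pos (div_pos (fpos s hs) hA0) (div_pos (gpos _ (Tmem s hs)) hB0)
  set P : ℝ → ℝ := fun s => (1 - p) * s + p * T s with hP
  set P' : ℝ → ℝ := fun s => (1 - p) + p * D s with hP'
  have P'pos : ∀ s ∈ Ioo a b, 0 < P' s := fun s hs => by
    have := mul_pos hp0 (Dpos s hs)
    simp only [hP']; linarith
  have Pd : ∀ s ∈ Ioo a b, HasDerivWithinAt P (P' s) (Ioo a b) s := by
    intro s hs
    have := ((hasDerivAt_id s).const_mul (1 - p)).add ((Td s hs).const_mul p)
    simp only [mul_one] at this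
    exact this.hasDerivWithinAt
  have Pm : StrictMonoOn P (Ioo a b) := by
    intro x hx y hy hxy
    have h1 := Tm hx hy hxy
    have h2 : 0 < 1 - p := by linarith
    simp only [hP]
    gcongr
  have hch := integral_image_eq_integral_abs_deriv_smul measurableSet_Ioo Pd Pm.injOn h
  have hci := (integrableOn_image_iff_integrableOn_abs_deriv_smul measurableSet_Ioo Pd
    Pm.injOn h).1 hi.integrableOn
  -- pointwise
  have key1 : ∀ s ∈ Ioo a b, P' s * (f s ^ (1 - p) * g (T s) ^ p) ≤ |P' s| • h (P s) := by
    intro s hs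
    rw [abs_of_pos (P'pos s hs), smul_eq_mul]
    exact mul_le_mul_of_nonneg_left (hh s hs _ (Tmem s hs)) (P'pos s hs).le
  have key0 : ∀ s ∈ Ioo a b, D s ^ p * (f s ^ (1 - p) * g (T s) ^ p) = f s * (B / A) ^ p := by
    intro s hs
    have hfs := fpos s hs
    have hgs := gpos _ (Tmem s hs)
    have e1 : D s = f s * (B / A) / g (T s) := by
      simp only [hD]; field_simp
    rw [e1, Real.div_rpow (by positivity) hgs.le, Real.mul_rpow hfs.le (by positivity)]
    have e2 : f s ^ p * f s ^ (1 - p) = f s := by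
      rw [← Real.rpow_add hfs]; simp
    have : g (T s) ^ p ≠ 0 := (Real.rpow_pos_of_pos hgs p).ne'
    calc f s ^ p * (B / A) ^ p / g (T s) ^ p * (f s ^ (1 - p) * g (T s) ^ p)
        = (f s ^ p * f s ^ (1 - p)) * (B / A) ^ p * (g (T s) ^ p / g (T s) ^ p) := by ring
      _ = _ := by rw [div_self this, e2, mul_one]
  have wpos : ∀ s ∈ Ioo a b, 0 < f s ^ (1 - p) * g (T s) ^ p := fun s hs =>
    mul_pos (Real.rpow_pos_of_pos (fpos s hs) _) (Real.rpow_pos_of_pos (gpos _ (Tmem s hs)) _)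
  have key2 : ∀ s ∈ Ioo a b, f s * (B / A) ^ p ≤ P' s * (f s ^ (1 - p) * g (T s) ^ p) := by
    intro s hs
    rw [← key0 s hs]
    exact mul_le_mul_of_nonneg_right (amgm_le (Dpos s hs) hp0 hp1) (wpos s hs).le
  have hle1 : ∫ s in Ioo a b, f s * (B / A) ^ p ≤ ∫ s in Ioo a b, |P' s| • h (P s) :=
    setIntegral_mono_on (hfi.mul_const _) hci measurableSet_Ioo
      (fun s hs => (key2 s hs).trans (key1 s hs))
  have hle2 : ∫ s in P '' Ioo a b, h s ≤ ∫ s, h s :=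
    setIntegral_le_integral hi (Filter.Eventually.of_forall h0)
  rw [integral_mul_const, hA] at hle1
  constructor
  · refine le_trans (le_of_eq ?_) (hle1.trans (hch ▸ hle2))
    rw [Real.div_rpow hB0.le hA0.le, Real.rpow_sub hA0, Real.rpow_one]
    ring
  · rintro rfl hhA
    rw [div_self hA0.ne', Real.one_rpow] at *
    have heq : ∫ s in Ioo a b, (|P' s| • h (P s) - f s) = 0 := by
      rw [integral_sub hci hfi, hA, ← hch]
      rw [← hch] at hle1
      linarith
    have hae : (fun s => |P' s| • h (P s) - f s) =ᵐ[volume.restrict (Ioo a b)] 0 := by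
      refine (setIntegral_eq_zero_iff_of_nonneg_ae ?_ (hci.sub hfi)).1 heq
      filter_upwards [ae_restrict_mem measurableSet_Ioo] with s hs
      have h1 := key1 s hs
      have h2 := key2 s hs
      simp only [mul_one] at h2
      change 0 ≤ |P' s| • h (P s) - f s
      linarith
    have hDae : D =ᵐ[volume.restrict (Ioo a b)] fun _ => 1 := by
      filter_upwards [hae, ae_restrict_mem measurableSet_Ioo] with s hs' hs
      have h1 := key1 s hs
      have h2 := key2 s hs
      have h3 := key0 s hs
      simp only [mul_one] at h2 h3
      simp only [Pi.zero_apply] at hs'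
      apply amgm_eq (Dpos s hs) hp0 hp1
      apply mul_right_cancel₀ (wpos s hs).ne'
      rw [h3]
      change f s = P' s * _
      linarith
    have Tc : ContinuousOn T (Ioo a b) := fun s hs => (Td s hs).continuousAt.continuousWithinAt
    have Dc : ContinuousOn D (Ioo a b) := by
      refine ContinuousOn.div (hf.div_const _) ((hg.comp Tc Tmem).div_const _) ?_
      intro s hs
      exact (div_pos (gpos _ (Tmem s hs)) hB0).ne'
    have D1 : EqOn D (fun _ => 1) (Ioo a b) :=
      Measure.eqOn_open_of_ae_eq hDae isOpen_Ioo Dc continuousOn_const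
    have hTd : ∀ s ∈ Ioo a b, HasDerivAt (fun s => s - T s) 0 s := by
      intro s hs
      have h1 := (hasDerivAt_id s).sub (Td s hs)
      have h2 : D s = 1 := D1 hs
      simp only [hD] at h2
      rw [h2, sub_self] at h1
      exact h1
    obtain ⟨d, hd⟩ := isOpen_Ioo.exists_is_const_of_deriv_eq_zero (f := fun s => s - T s)
      isPreconnected_Ioo
      (fun s hs => (hTd s hs).differentiableAt.differentiableWithinAt)
      (fun s hs => (hTd s hs).deriv)
    have hTs : ∀ s ∈ Ioo a b, T s = s - d := fun s hs => by
      have := hd s hs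
      linarith
    refine ⟨d, fun s => ⟨fun hs => hTs s hs ▸ Tmem s hs, fun hs => ?_⟩, fun s hs => ?_⟩
    · rw [← Ti] at hs
      obtain ⟨x, hx, hx'⟩ := hs
      rw [hTs x hx] at hx'
      have : x = s := by linarith
      exact this ▸ hx
    · have h2 : D s = 1 := D1 hs
      have hgs := gpos _ (Tmem s hs)
      rw [← hTs s hs]
      have h3 : f s / A / (g (T s) / A) = 1 := h2
      rw [div_div_div_cancel_right₀ hA0.ne', div_eq_one_iff_eq hgs.ne'] at h3
      exact h3

/-- Nonempty bounded open convex sets. -/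
structure NiceSet {E : Type*} [NormedAddCommGroup E] [NormedSpace ℝ E] (U : Set E) : Prop where
  isOpen : IsOpen U
  convex : Convex ℝ U
  bdd : Bornology.IsBounded U
  nonempty : U.Nonempty

/-- The multiplicative Brunn-Minkowski property for nice sets. -/
def BMProp {E : Type*} [NormedAddCommGroup E] [NormedSpace ℝ E] [MeasurableSpace E]
    (μ : Measure E) : Prop :=
  ∀ U V : Set E, NiceSet U → NiceSet V → ∀ p : ℝ, 0 < p → p < 1 →
    μ.real U ^ (1 - p) * μ.real V ^ p ≤ μ.real ((1 - p) • U + p • V)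

lemma NiceSet.comb {E : Type*} [NormedAddCommGroup E] [NormedSpace ℝ E] {U V : Set E}
    (hU : NiceSet U) (hV : NiceSet V) {p : ℝ} (hp1 : p < 1) :
    NiceSet ((1 - p) • U + p • V) where
  isOpen := (hU.isOpen.smul₀ (by linarith : (1 - p) ≠ 0)).add_right
  convex := (hU.convex.smul _).add (hV.convex.smul _)
  bdd := (hU.bdd.smul₀ _).add (hV.bdd.smul₀ _)
  nonempty := hU.nonempty.smul_set.add hV.nonempty.smul_set

section
variable {F : Type*} [NormedAddCommGroup F] [NormedSpace ℝ F]

lemma NiceSet.slice {U : Set (ℝ × F)} (hU : NiceSet U) {s : ℝ}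
    (hs : (Prod.mk s ⁻¹' U).Nonempty) : NiceSet (Prod.mk s ⁻¹' U) where
  isOpen := hU.isOpen.preimage (by fun_prop)
  convex := by
    intro x hx y hy a b ha hb hab
    have := hU.convex hx hy ha hb hab
    simp only [Prod.smul_mk, Prod.mk_add_mk, ← add_smul, hab, one_smul] at this
    exact this
  bdd := (Bornology.IsBounded.image_snd hU.bdd).subset (fun x hx => ⟨(s, x), hx, rfl⟩)
  nonempty := hs

lemma NiceSet.slice_interval {U : Set (ℝ × F)} (hU : NiceSet U) :
    ∃ a b : ℝ, a < b ∧ ∀ s, (Prod.mk s ⁻¹' U).Nonempty ↔ s ∈ Ioo a b := by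
  set J := Prod.fst '' U with hJ
  have Jo : IsOpen J := isOpenMap_fst U hU.isOpen
  have Jc : Convex ℝ J := hU.convex.linear_image (LinearMap.fst ℝ ℝ F)
  have Jb : Bornology.IsBounded J := Bornology.IsBounded.image_fst hU.bdd
  have Jn : J.Nonempty := hU.nonempty.image _
  have hmem : ∀ s, (Prod.mk s ⁻¹' U).Nonempty ↔ s ∈ J := by
    intro s
    constructor
    · rintro ⟨x, hx⟩; exact ⟨(s, x), hx, rfl⟩
    · rintro ⟨⟨t, x⟩, hx, rfl⟩; exact ⟨x, hx⟩
  have hJ2 : J = Ioo (sInf J) (sSup J) := by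
    apply Subset.antisymm
    · intro x hx
      obtain ⟨l, hl, hl'⟩ := Metric.isOpen_iff.1 Jo x hx
      have h1 : x - l / 2 ∈ J := hl' (by simp [abs_of_pos hl]; linarith)
      have h2 : x + l / 2 ∈ J := hl' (by simp [abs_of_pos hl]; linarith)
      exact ⟨by linarith [csInf_le Jb.bddBelow h1], by linarith [le_csSup Jb.bddAbove h2]⟩
    · exact IsConnected.Ioo_csInf_csSup_subset ⟨Jn, Jc.isPreconnected⟩ Jb.bddBelow Jb.bddAbove
  refine ⟨sInf J, sSup J, ?_, fun s => by rw [hmem, ← hJ2]⟩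
  obtain ⟨x, hx⟩ := Jn
  rw [hJ2] at hx
  exact hx.1.trans hx.2

lemma slice_comb_subset (U V : Set (ℝ × F)) (p s t : ℝ) :
    (1 - p) • (Prod.mk s ⁻¹' U) + p • (Prod.mk t ⁻¹' V) ⊆
      Prod.mk ((1 - p) * s + p * t) ⁻¹' ((1 - p) • U + p • V) := by
  rintro _ ⟨_, ⟨x, hx, rfl⟩, _, ⟨y, hy, rfl⟩, rfl⟩
  exact ⟨_, ⟨_, hx, rfl⟩, _, ⟨_, hy, rfl⟩, by simp⟩

variable [MeasurableSpace F] [BorelSpace F] [FiniteDimensional ℝ F] (ν : Measure F)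
  [ν.IsAddHaarMeasure]

lemma NiceSet.measure_ne_top {U : Set F} (hU : NiceSet U) : ν U ≠ ⊤ := hU.bdd.measure_lt_top.ne

lemma NiceSet.real_pos {U : Set F} (hU : NiceSet U) : 0 < ν.real U :=
  ENNReal.toReal_pos (hU.isOpen.measure_pos ν hU.nonempty).ne' (hU.measure_ne_top ν)

lemma slice_integrable {U : Set (ℝ × F)} (hU : NiceSet U) :
    Integrable (fun s => ν.real (Prod.mk s ⁻¹' U)) := by
  have hfin : (volume.prod ν : Measure (ℝ × F)) U ≠ ⊤ := hU.measure_ne_top _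
  exact Measure.integrable_measure_prodMk_left hU.isOpen.measurableSet hfin

lemma slice_integral {U : Set (ℝ × F)} (hU : NiceSet U) :
    ∫ s, ν.real (Prod.mk s ⁻¹' U) = (volume.prod ν : Measure (ℝ × F)).real U := by
  have hfin : (volume.prod ν : Measure (ℝ × F)) U ≠ ⊤ := hU.measure_ne_top _
  have hm := hU.isOpen.measurableSet
  rw [measureReal_def, Measure.prod_apply hm]
  refine integral_toReal (measurable_measure_prodMk_left hm).aemeasurable ?_
  exact Measure.ae_measure_lt_top hm hfin

lemma slice_continuousOn (hν : BMProp ν) {U : Set (ℝ × F)} (hU : NiceSet U) {a b : ℝ}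
    (hs : ∀ s, (Prod.mk s ⁻¹' U).Nonempty ↔ s ∈ Ioo a b) :
    ContinuousOn (fun s => ν.real (Prod.mk s ⁻¹' U)) (Ioo a b) := by
  have hpos : ∀ s ∈ Ioo a b, 0 < ν.real (Prod.mk s ⁻¹' U) := fun s h =>
    (hU.slice ((hs s).2 h)).real_pos ν
  have hc : ConcaveOn ℝ (Ioo a b) (fun s => Real.log (ν.real (Prod.mk s ⁻¹' U))) := by
    refine ⟨convex_Ioo a b, ?_⟩
    intro x hx y hy l m hl hm hlm
    rcases hl.eq_or_lt with rfl | hl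
    · have : m = 1 := by linarith
      subst this; simp
    rcases hm.eq_or_lt with rfl | hm
    · have : l = 1 := by linarith
      subst this; simp
    obtain rfl : l = 1 - m := by linarith
    have h1 := hν _ _ (hU.slice ((hs x).2 hx)) (hU.slice ((hs y).2 hy)) m hm (by linarith)
    have h2 : (1 - m) • U + m • U = U := by
      rw [← hU.convex.add_smul hl.le hm.le, hlm, one_smul]
    have h3 := slice_comb_subset U U m x y
    rw [h2] at h3
    have hmem : (1 - m) * x + m * y ∈ Ioo a b := (convex_Ioo a b) hx hy hl.le hm.le hlm
    have h4 : ν.real ((1 - m) • (Prod.mk x ⁻¹' U) + m • (Prod.mk y ⁻¹' U)) ≤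
        ν.real (Prod.mk ((1 - m) * x + m * y) ⁻¹' U) :=
      measureReal_mono h3 ((hU.slice ((hs _).2 hmem)).measure_ne_top ν)
    have px := hpos x hx
    have py := hpos y hy
    have h5 := Real.log_le_log (mul_pos (Real.rpow_pos_of_pos px _) (Real.rpow_pos_of_pos py _))
      (h1.trans h4)
    rw [Real.log_mul (Real.rpow_pos_of_pos px _).ne' (Real.rpow_pos_of_pos py _).ne',
      Real.log_rpow px, Real.log_rpow py] at h5
    exact h5
  have h1 := (hc.continuousOn isOpen_Ioo).rexp
  refine h1.congr fun s h => ?_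
  exact (Real.exp_log (hpos s h)).symm

lemma step (hν : BMProp ν) {U V : Set (ℝ × F)} (hU : NiceSet U) (hV : NiceSet V) {p : ℝ}
    (hp0 : 0 < p) (hp1 : p < 1) {μ : Measure (ℝ × F)} (hμ : μ = volume.prod ν) :
    μ.real U ^ (1 - p) * μ.real V ^ p ≤ μ.real ((1 - p) • U + p • V) ∧
    (μ.real U = μ.real V → μ.real ((1 - p) • U + p • V) = μ.real U →
      ∃ d, ∀ s, ν.real (Prod.mk s ⁻¹' U) = ν.real (Prod.mk (s - d) ⁻¹' V)) := by
  obtain ⟨a, b, hab, hs⟩ := hU.slice_interval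
  obtain ⟨a', b', hab', hs'⟩ := hV.slice_interval
  have hM : NiceSet ((1 - p) • U + p • V) := hU.comb hV hp1
  have zU : ∀ s, s ∉ Ioo a b → ν.real (Prod.mk s ⁻¹' U) = 0 := by
    intro s h
    rw [← hs, not_nonempty_iff_eq_empty] at h
    rw [h, measureReal_empty]
  have zV : ∀ s, s ∉ Ioo a' b' → ν.real (Prod.mk s ⁻¹' V) = 0 := by
    intro s h
    rw [← hs', not_nonempty_iff_eq_empty] at h
    rw [h, measureReal_empty]
  subst hμ
  have hA := slice_integral ν hU
  have hB := slice_integral ν hV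
  rw [← setIntegral_eq_integral_of_forall_compl_eq_zero zU] at hA
  rw [← setIntegral_eq_integral_of_forall_compl_eq_zero zV] at hB
  have h := oneD hab hab' (slice_continuousOn ν hν hU hs)
    (fun s h => (hU.slice ((hs s).2 h)).real_pos ν) (slice_integrable ν hU).integrableOn
    (slice_continuousOn ν hν hV hs')
    (fun s h => (hV.slice ((hs' s).2 h)).real_pos ν) (slice_integrable ν hV).integrableOn
    hA hB (hU.real_pos _) (hV.real_pos _)
    (h := fun s => ν.real (Prod.mk s ⁻¹' ((1 - p) • U + p • V))) (fun s => measureReal_nonneg)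
    (slice_integrable ν hM) hp0 hp1 (by
      intro s h t h'
      have h1 := hν _ _ (hU.slice ((hs s).2 h)) (hV.slice ((hs' t).2 h')) p hp0 hp1
      refine h1.trans (measureReal_mono (slice_comb_subset U V p s t) ?_)
      refine (hM.slice ?_).measure_ne_top ν
      exact ((hU.slice ((hs s).2 h)).comb (hV.slice ((hs' t).2 h')) hp1).nonempty.mono
        (slice_comb_subset U V p s t))
  rw [slice_integral ν hM] at h
  refine ⟨h.1, fun h1 h2 => ?_⟩
  obtain ⟨d, hd, hd'⟩ := h.2 h1 h2
  refine ⟨d, fun s => ?_⟩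
  by_cases hsm : s ∈ Ioo a b
  · exact hd' s hsm
  · rw [zU s hsm, zV _ (fun h => hsm ((hd s).2 h))]

end

section
variable {F : Type*} [NormedAddCommGroup F] [NormedSpace ℝ F] [MeasurableSpace F] [BorelSpace F]
  [FiniteDimensional ℝ F] (ν : Measure F) [ν.IsAddHaarMeasure]
  {E : Type*} [NormedAddCommGroup E] [NormedSpace ℝ E] [MeasurableSpace E] [BorelSpace E]
  [FiniteDimensional ℝ E] (μ : Measure E) [μ.IsAddHaarMeasure]

lemma slice_marginal {U V : Set (ℝ × F)} (hU : NiceSet U) (hV : NiceSet V) {d : ℝ}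
    (h : ∀ s, ν.real (Prod.mk s ⁻¹' U) = ν.real (Prod.mk (s - d) ⁻¹' V)) {B : Set ℝ}
    (hB : MeasurableSet B) :
    (volume.prod ν : Measure (ℝ × F)) (Prod.fst ⁻¹' B ∩ U) =
      (volume.prod ν : Measure (ℝ × F)) ((fun x => x.1 + d) ⁻¹' B ∩ V) := by
  have h' : ∀ s, ν (Prod.mk s ⁻¹' U) = ν (Prod.mk (s - d) ⁻¹' V) := by
    intro s
    have h1 : ν (Prod.mk s ⁻¹' U) ≠ ⊤ := by
      rcases (Prod.mk s ⁻¹' U).eq_empty_or_nonempty with h | h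
      · simp [h]
      · exact (hU.slice h).measure_ne_top ν
    have h2 : ν (Prod.mk (s - d) ⁻¹' V) ≠ ⊤ := by
      rcases (Prod.mk (s - d) ⁻¹' V).eq_empty_or_nonempty with h | h
      · simp [h]
      · exact (hV.slice h).measure_ne_top ν
    exact (ENNReal.toReal_eq_toReal_iff' h1 h2).1 (h s)
  have m1 : Measurable (fun x : ℝ × F => x.1 + d) := by fun_prop
  rw [Measure.prod_apply ((measurable_fst hB).inter hU.isOpen.measurableSet),
    Measure.prod_apply ((m1 hB).inter hV.isOpen.measurableSet)]
  rw [← lintegral_sub_right_eq_self (fun x => ν (Prod.mk x ⁻¹' ((fun x => x.1 + d) ⁻¹' B ∩ V))) d]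
  refine lintegral_congr fun s => ?_
  by_cases hs : s ∈ B
  · have e1 : Prod.mk s ⁻¹' (Prod.fst ⁻¹' B ∩ U) = Prod.mk s ⁻¹' U := by
      ext x; simp [hs]
    have e2 : Prod.mk (s - d) ⁻¹' ((fun x => x.1 + d) ⁻¹' B ∩ V) = Prod.mk (s - d) ⁻¹' V := by
      ext x; simp [hs]
    rw [e1, e2, h']
  · have e1 : Prod.mk s ⁻¹' (Prod.fst ⁻¹' B ∩ U) = ∅ := by
      ext x; simp [hs]
    have e2 : Prod.mk (s - d) ⁻¹' ((fun x => x.1 + d) ⁻¹' B ∩ V) = ∅ := by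
      ext x; simp [hs]
    rw [e1, e2]

lemma transfer (e : E ≃L[ℝ] F) : ∃ c : NNReal, 0 < c ∧ ∀ S : Set E, μ S = c * ν (e '' S) := by
  have : (Measure.map e μ).IsAddHaarMeasure := e.isAddHaarMeasure_map μ
  have h := Measure.isAddLeftInvariant_eq_smul (Measure.map e μ) ν
  refine ⟨_, Measure.addHaarScalarFactor_pos_of_isAddHaarMeasure (Measure.map e μ) ν, ?_⟩
  intro S
  have h1 : Measure.map e μ (e '' S) = μ S := by
    have : (e : E → F) = e.toHomeomorph.toMeasurableEquiv := rfl
    rw [this, MeasurableEquiv.map_apply, ← this, preimage_image_eq _ e.injective]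
  rw [← h1]
  conv_lhs => rw [h]
  rfl

lemma NiceSet.image {U : Set E} (hU : NiceSet U) (e : E ≃L[ℝ] F) : NiceSet (e '' U) where
  isOpen := e.toHomeomorph.isOpenMap U hU.isOpen
  convex := hU.convex.linear_image (e : E →ₗ[ℝ] F)
  bdd := (e : E →L[ℝ] F).lipschitz.isBounded_image hU.bdd
  nonempty := hU.nonempty.image _

lemma full_step (ℓ : E →L[ℝ] ℝ) (hℓ : ℓ ≠ 0)
    (hν : ∀ ν : Measure (LinearMap.ker (ℓ : E →ₗ[ℝ] ℝ)), ν.IsAddHaarMeasure → BMProp ν)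
    {U V : Set E} (hU : NiceSet U) (hV : NiceSet V) {p : ℝ} (hp0 : 0 < p) (hp1 : p < 1) :
    μ.real U ^ (1 - p) * μ.real V ^ p ≤ μ.real ((1 - p) • U + p • V) ∧
    (μ.real U = μ.real V → μ.real ((1 - p) • U + p • V) = μ.real U →
      ∃ d, ∀ B : Set ℝ, MeasurableSet B →
        μ (ℓ ⁻¹' B ∩ U) = μ ((fun x => ℓ x + d) ⁻¹' B ∩ V)) := by
  obtain ⟨v, hv⟩ : ∃ v, ℓ v = 1 := by
    obtain ⟨w, hw⟩ : ∃ w, ℓ w ≠ 0 := by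
      by_contra! h
      exact hℓ (ContinuousLinearMap.ext h)
    exact ⟨(ℓ w)⁻¹ • w, by simp [hw]⟩
  let e : E ≃L[ℝ] ℝ × LinearMap.ker (ℓ : E →ₗ[ℝ] ℝ) :=
    ContinuousLinearEquiv.equivOfRightInverse ℓ (ContinuousLinearMap.toSpanSingleton ℝ v)
      (fun x => by simp [hv])
  have he : ∀ x, (e x).1 = ℓ x := fun x => rfl
  let ν : Measure (LinearMap.ker (ℓ : E →ₗ[ℝ] ℝ)) := Measure.addHaar
  obtain ⟨c, hc, hcS⟩ := transfer (volume.prod ν) μ e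
  have hcR : ∀ S, μ.real S = c * (volume.prod ν).real (e '' S) := by
    intro S
    simp [measureReal_def, hcS]
  have hc' : (0 : ℝ) < c := hc
  have him : e '' ((1 - p) • U + p • V) = (1 - p) • (e '' U) + p • (e '' V) := by
    rw [image_add, image_smul_set, image_smul_set]
  have h := step ν (hν ν inferInstance) (hU.image e) (hV.image e) hp0 hp1 rfl
  rw [hcR, hcR, hcR, him]
  constructor
  · rw [Real.mul_rpow hc'.le measureReal_nonneg, Real.mul_rpow hc'.le measureReal_nonneg]
    have e2 : (c : ℝ) ^ (1 - p) * (c : ℝ) ^ p = c := by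
      rw [← Real.rpow_add hc']; simp
    calc _ = ((c : ℝ) ^ (1 - p) * (c : ℝ) ^ p) * ((volume.prod ν).real (e '' U) ^ (1 - p) *
            (volume.prod ν).real (e '' V) ^ p) := by ring
      _ ≤ _ := by
        rw [e2]
        exact mul_le_mul_of_nonneg_left h.1 hc'.le
  · intro h1 h2
    obtain ⟨d, hd⟩ := h.2 (mul_left_cancel₀ hc'.ne' h1) (mul_left_cancel₀ hc'.ne' h2)
    refine ⟨d, fun B hB => ?_⟩
    rw [hcS, hcS]
    have e1 : e '' (ℓ ⁻¹' B ∩ U) = Prod.fst ⁻¹' B ∩ e '' U := by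
      rw [← image_preimage_inter]
      ext; simp [he]
    have e2 : e '' ((fun x => ℓ x + d) ⁻¹' B ∩ V) = (fun x => x.1 + d) ⁻¹' B ∩ e '' V := by
      rw [inter_comm, inter_comm _ (e '' V), ← image_inter_preimage]
      rfl
    rw [e1, e2, slice_marginal ν (hU.image e) (hV.image e) hd hB]

end

theorem bm_all (n : ℕ) : ∀ (E : Type) [NormedAddCommGroup E] [NormedSpace ℝ E] [MeasurableSpace E]
    [BorelSpace E] [FiniteDimensional ℝ E] (μ : Measure E) [μ.IsAddHaarMeasure],
    Module.finrank ℝ E = n → BMProp μ := by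
  induction n with
  | zero =>
    intro E _ _ _ _ _ μ _ hE U V hU hV p hp0 hp1
    have : Subsingleton E := Module.finrank_zero_iff.1 hE
    have h1 : U = univ := hU.nonempty.eq_univ
    have h2 : V = univ := hV.nonempty.eq_univ
    have h3 : (1 - p) • U + p • V = univ := (hU.comb hV hp1).nonempty.eq_univ
    rw [h3, h1, h2]
    have : 0 < μ.real (univ : Set E) := h1 ▸ hU.real_pos μ
    rw [← Real.rpow_add this]
    simp
  | succ n ih =>
    intro E _ _ _ _ _ μ _ hE U V hU hV p hp0 hp1
    have : Nontrivial E := Module.nontrivial_of_finrank_pos (R := ℝ) (by omega)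
    obtain ⟨w, hw⟩ := exists_ne (0 : E)
    obtain ⟨ℓ, -, hℓw⟩ := exists_dual_vector ℝ w (norm_ne_zero_iff.2 hw)
    have hℓ : ℓ ≠ 0 := by
      rintro rfl
      simp at hℓw
      exact hw (norm_eq_zero.1 hℓw.symm)
    refine (full_step μ ℓ hℓ (fun ν _ => ih _ ν ?_) hU hV hp0 hp1).1
    have hℓ' : (ℓ : E →ₗ[ℝ] ℝ) ≠ 0 := fun h => hℓ (ContinuousLinearMap.coe_injective h)
    have := Module.Dual.finrank_ker_add_one_of_ne_zero hℓ'
    omega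

lemma NiceSet.neg {E : Type*} [NormedAddCommGroup E] [NormedSpace ℝ E] {U : Set E}
    (hU : NiceSet U) : NiceSet (-U) where
  isOpen := hU.isOpen.neg
  convex := hU.convex.neg
  bdd := hU.bdd.neg
  nonempty := hU.nonempty.neg

theorem eq_case (E : Type) [NormedAddCommGroup E] [NormedSpace ℝ E] [MeasurableSpace E]
    [BorelSpace E] [FiniteDimensional ℝ E] (μ : Measure E) [μ.IsAddHaarMeasure] {U : Set E}
    (hU : NiceSet U)
    (h : μ.real ((1 - (1 / 2 : ℝ)) • U + (1 / 2 : ℝ) • (-U)) = μ.real U) :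
    ∃ c : E, ∀ ℓ : E →L[ℝ] ℝ, ℓ ≠ 0 → ∀ B : Set ℝ, MeasurableSet B →
      μ (ℓ ⁻¹' B ∩ U) = μ ((fun x => ℓ ((2 : ℝ) • c - x)) ⁻¹' B ∩ U) := by
  refine ⟨(μ.real U)⁻¹ • ∫ x in U, x ∂μ, fun ℓ hℓ => ?_⟩
  have hneg : μ.real (-U) = μ.real U := by simp [measureReal_def]
  have hpos := hU.real_pos μ
  obtain ⟨d, hd⟩ := (full_step μ ℓ hℓ (fun ν _ => bm_all _ _ ν rfl) hU hU.neg
    (p := 1 / 2) (by norm_num) (by norm_num)).2 hneg.symm h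
  have hfinU : IsFiniteMeasure (μ.restrict U) :=
    isFiniteMeasure_restrict.2 (hU.measure_ne_top μ)
  have hint : IntegrableOn (fun x : E => x) U μ := by
    have hc : IsCompact (closure U) := hU.bdd.isCompact_closure
    exact (continuous_id.continuousOn.integrableOn_compact hc).mono_set subset_closure
  have hmap : (μ.restrict U).map ℓ = (μ.restrict (-U)).map (fun x => ℓ x + d) := by
    ext B hB
    have m1 : Measurable (fun x => ℓ x + d) := by fun_prop
    have m2 : Measurable ℓ := by fun_prop
    rw [Measure.map_apply m2 hB, Measure.map_apply m1 hB, Measure.restrict_apply (m2 hB),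
      Measure.restrict_apply (m1 hB), hd B hB]
  have hI : ∫ x in U, ℓ x ∂μ = ∫ x in -U, (ℓ x + d) ∂μ := by
    have h1 : ∫ y, y ∂((μ.restrict U).map ℓ) = ∫ x in U, ℓ x ∂μ :=
      integral_map (by fun_prop) (by fun_prop)
    have h2 : ∫ y, y ∂((μ.restrict (-U)).map (fun x => ℓ x + d)) = ∫ x in -U, (ℓ x + d) ∂μ :=
      integral_map (by fun_prop) (by fun_prop)
    rw [← h1, ← h2, hmap]
  have hN : ∫ x in -U, (ℓ x + d) ∂μ = ∫ x in U, (-ℓ x + d) ∂μ := by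
    have := (Measure.measurePreserving_neg μ).setIntegral_preimage_emb
      (MeasurableEquiv.neg E).measurableEmbedding (fun x => ℓ x + d) (-U)
    rw [← this]
    simp
  have hintℓ : IntegrableOn (fun x => ℓ x) U μ := ℓ.integrable_comp hint
  have hintn : IntegrableOn (fun x => -ℓ x) U μ := hintℓ.neg
  rw [hN, integral_add hintn (integrable_const d), integral_neg, setIntegral_const,
    smul_eq_mul] at hI
  have hℓc : ℓ ((μ.real U)⁻¹ • ∫ x in U, x ∂μ) = (μ.real U)⁻¹ * ∫ x in U, ℓ x ∂μ := by
    rw [map_smul, smul_eq_mul, ← ℓ.integral_comp_comm hint]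
  have hd2 : d = 2 * ℓ ((μ.real U)⁻¹ • ∫ x in U, x ∂μ) := by
    rw [hℓc]
    field_simp
    linarith
  intro B hB
  rw [hd B hB, ← Measure.measure_neg μ]
  congr 1
  ext x
  simp only [mem_neg, mem_inter_iff, mem_preimage, neg_neg, map_sub, map_neg, map_smul ℓ (2 : ℝ),
    smul_eq_mul, ← hd2]
  rw [neg_add_eq_sub]

/-- The volume of a convex body is at most that of its central symmetral, with equality
iff K is centrally symmetric about some center c. -/
theorem volume_le_centralSymmetral (n : ℕ) (K : Set (EuclideanSpace ℝ (Fin n)))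
    (hK : IsConvexBody K) :
    volume K ≤ volume (centralSymmetral K) ∧
      (volume K = volume (centralSymmetral K) ↔
        ∃ c : EuclideanSpace ℝ (Fin n), ∀ x, x ∈ K ↔ (2:ℝ) • c - x ∈ K) := by
  obtain ⟨hKc, hKv, hKi⟩ := hK
  set U := interior K with hUdef
  have hU : NiceSet U := ⟨isOpen_interior, hKv.interior, hKc.isBounded.subset interior_subset, hKi⟩
  have hcl : closure U = K := by
    rw [hUdef, hKv.closure_interior_eq_closure_of_nonempty_interior hKi, hKc.isClosed.closure_eq]
  have hvol : volume K = volume U := by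
    rw [← hcl]
    exact measure_congr (closure_ae_eq_of_null_frontier (hU.convex.addHaar_frontier volume))
  have hM : NiceSet ((1 - (1 / 2 : ℝ)) • U + (1 / 2 : ℝ) • (-U)) :=
    hU.comb hU.neg (by norm_num)
  have hsub : (1 - (1 / 2 : ℝ)) • U + (1 / 2 : ℝ) • (-U) ⊆ centralSymmetral K := by
    have e : (1 - (1 / 2 : ℝ)) = (2:ℝ)⁻¹ := by norm_num
    rw [e, one_div, ← smul_add]
    exact smul_set_mono (add_subset_add interior_subset (neg_subset_neg.2 interior_subset))
  have hneg : volume.real (-U) = volume.real U := by simp [measureReal_def]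
  have hBM : volume.real U ≤ volume.real ((1 - (1 / 2 : ℝ)) • U + (1 / 2 : ℝ) • (-U)) := by
    have := bm_all _ _ (volume : Measure (EuclideanSpace ℝ (Fin n))) rfl U (-U) hU hU.neg (1 / 2)
      (by norm_num) (by norm_num)
    rw [hneg, ← Real.rpow_add (hU.real_pos _)] at this
    simpa using this
  have hBM' : volume U ≤ volume ((1 - (1 / 2 : ℝ)) • U + (1 / 2 : ℝ) • (-U)) :=
    (ENNReal.toReal_le_toReal (hU.measure_ne_top _) (hM.measure_ne_top _)).1 hBM
  refine ⟨hvol ▸ hBM'.trans (measure_mono hsub), ?_, ?_⟩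
  · intro heq
    have h1 : volume ((1 - (1 / 2 : ℝ)) • U + (1 / 2 : ℝ) • (-U)) = volume U :=
      le_antisymm (by rw [← hvol, heq]; exact measure_mono hsub) hBM'
    obtain ⟨c, hc⟩ := eq_case _ volume hU (by rw [measureReal_def, h1, measureReal_def])
    have key : ∀ x ∈ K, (2:ℝ) • c - x ∈ K := by
      intro x hx
      by_contra hx'
      obtain ⟨ℓ, r, hr, hr'⟩ := geometric_hahn_banach_closed_point hKv hKc.isClosed hx'
      have hℓ : ℓ ≠ 0 := by
        rintro rfl
        have := hr x hx
        simp at this hr'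
        linarith
      have h2 := hc ℓ hℓ (Ioi r) measurableSet_Ioi
      have e1 : ℓ ⁻¹' (Ioi r) ∩ U = ∅ := by
        ext y
        simp only [mem_inter_iff, mem_preimage, mem_Ioi, mem_empty_iff_false, iff_false, not_and]
        intro hy hyU
        exact lt_asymm hy (hr y (interior_subset hyU))
      rw [e1, measure_empty] at h2
      have hopen : IsOpen ((fun x => ℓ ((2 : ℝ) • c - x)) ⁻¹' (Ioi r)) :=
        isOpen_Ioi.preimage (by fun_prop)
      have hne : ((fun x => ℓ ((2 : ℝ) • c - x)) ⁻¹' (Ioi r) ∩ U).Nonempty := by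
        rw [← hcl] at hx
        exact mem_closure_iff.1 hx _ hopen hr'
      exact ((hopen.inter hU.isOpen).measure_pos volume hne).ne h2
    refine ⟨c, fun x => ⟨key x, fun h => ?_⟩⟩
    simpa using key _ h
  · rintro ⟨c, hc⟩
    have : centralSymmetral K = (fun x => x + c) ⁻¹' K := by
      ext z
      constructor
      · rintro ⟨_, ⟨x, hx, y, hy, rfl⟩, rfl⟩
        have hy' := (hc (-y)).1 hy
        have := hKv hx hy' (by norm_num : (0:ℝ) ≤ 1 / 2) (by norm_num : (0:ℝ) ≤ 1 / 2)
          (by norm_num)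
        have e : (2:ℝ)⁻¹ • (x + y) + c = (1 / 2 : ℝ) • x + (1 / 2 : ℝ) • ((2:ℝ) • c - -y) := by
          module
        change (2:ℝ)⁻¹ • (x + y) + c ∈ K
        rwa [e]
      · intro hz
        have hz1 : z + c ∈ K := hz
        have hz2 := (hc _).1 hz1
        refine ⟨(z + c) + -((2:ℝ) • c - (z + c)), ⟨z + c, hz1, _, neg_mem_neg.2 hz2, rfl⟩, ?_⟩
        module
    rw [this, measure_preimage_add_right]
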